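/- Let μ > 0 and α, β > 0 with 2α + β = μ, and consider the monomeric Super-Kagome weights γ₁ = γ₂ = γ₃ = γ₄ = γ₅ = γ₆ = α, γ₇ = γ₈ = γ₉ = β. Then the set {λ ∈ ℝ : there exists θ ∈ ℝ² with det(λ·Id − Δ^θ_γ) = 0} equals [0, (1 − α/(2μ)) − |3α − 2β|/(2μ)] ∪ [(1 − α/(2μ)) + |3α − 2β|/(2μ), 2 − α/μ]. Moreover, for every θ ∈ ℝ², both 3α/μ and 2 − α/μ are eigenvalues of Δ^θ_γ (flat bands at 3α/μ and 2 − α/μ). -/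

import Mathlib

open Matrix

/-- The Super-Kagome Floquet adjacency matrix `Π^θ_γ`. -/
noncomputable def SKPi (g1 g2 g3 g4 g5 g6 g7 g8 g9 θ1 θ2 : ℝ) : Matrix (Fin 6) (Fin 6) ℂ :=
  let w : ℂ := Complex.exp (Complex.I * θ1)
  let z : ℂ := Complex.exp (Complex.I * θ2)
  !![0, (g4 : ℂ), (g6 : ℂ), 0, z * g9, 0;
     (g4 : ℂ), 0, (g5 : ℂ), 0, 0, w * g8;
     (g6 : ℂ), (g5 : ℂ), 0, (g7 : ℂ), 0, 0;
     0, 0, (g7 : ℂ), 0, (g3 : ℂ), (g2 : ℂ);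
     (starRingEnd ℂ) z * g9, 0, 0, (g3 : ℂ), 0, (g1 : ℂ);
     0, (starRingEnd ℂ) w * g8, 0, (g2 : ℂ), (g1 : ℂ), 0]

/-- The Super-Kagome Floquet Laplacian `Δ^θ_γ = Id − (1/μ) Π^θ_γ`. -/
noncomputable def SKDelta (g1 g2 g3 g4 g5 g6 g7 g8 g9 μ θ1 θ2 : ℝ) : Matrix (Fin 6) (Fin 6) ℂ :=
  1 - (μ : ℂ)⁻¹ • SKPi g1 g2 g3 g4 g5 g6 g7 g8 g9 θ1 θ2

/-- The determinant of two triangles of weight `a` joined by a matching of weight `b` whose edges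
carry the phases `z`, `w` and `1`. -/
theorem det_joined_triangles {R : Type*} [CommRing R] (x a b z z' w w' : R)
    (hz : z * z' = 1) (hw : w * w' = 1) :
    (!![x, a, a, 0, z * b, 0;
        a, x, a, 0, 0, w * b;
        a, a, x, b, 0, 0;
        0, 0, b, x, a, a;
        z' * b, 0, 0, a, x, a;
        0, w' * b, 0, a, a, x] : Matrix (Fin 6) (Fin 6) R).det =
      ((a - x) ^ 2 - b ^ 2) * (((a - x) ^ 2 - b ^ 2 - 3 * a * (a - x)) ^ 2
        - a ^ 2 * b ^ 2 * ((1 + z + w) * (1 + z' + w'))) := by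
  simp [Matrix.det_succ_row_zero, Fin.sum_univ_succ, Fin.succAbove]
  linear_combination
    (-2 * x * a ^ 3 * b ^ 2 + 3 * x ^ 2 * a ^ 2 * b ^ 2 + x ^ 2 * b ^ 4 * w' * w + x ^ 2 * b ^ 4
      - x ^ 4 * b ^ 2 + a ^ 2 * b ^ 4 * w' - a ^ 2 * b ^ 4 + a ^ 2 * b ^ 4 * w
      - b ^ 6 * w' * w) * hz
    + (-2 * x * a ^ 3 * b ^ 2 + 3 * x ^ 2 * a ^ 2 * b ^ 2 + 2 * x ^ 2 * b ^ 4 - x ^ 4 * b ^ 2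
      - a ^ 2 * b ^ 4 + a ^ 2 * b ^ 4 * z' + a ^ 2 * b ^ 4 * z - b ^ 6) * hw

theorem exp_I_mul_conj (t : ℝ) :
    Complex.exp (Complex.I * t) * (starRingEnd ℂ) (Complex.exp (Complex.I * t)) = 1 := by
  rw [Complex.mul_conj, Complex.normSq_eq_norm_sq, mul_comm, Complex.norm_exp_ofReal_mul_I]
  simp

/-- The dispersion relation of the monomeric Super-Kagome Laplacian. -/
theorem det_smul_one_sub_SKDelta (α β μ θ1 θ2 lam : ℝ) :
    Matrix.det ((lam : ℂ) • (1 : Matrix (Fin 6) (Fin 6) ℂ)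
      - SKDelta α α α α α α β β β μ θ1 θ2) =
    (((((α / μ - (lam - 1)) ^ 2 - (β / μ) ^ 2)
      * (((α / μ - (lam - 1)) ^ 2 - (β / μ) ^ 2 - 3 * (α / μ) * (α / μ - (lam - 1))) ^ 2
        - (α / μ) ^ 2 * (β / μ) ^ 2 * Complex.normSq
          (1 + Complex.exp (Complex.I * θ2) + Complex.exp (Complex.I * θ1))) : ℝ)) : ℂ) := by
  have h := det_joined_triangles ((lam : ℂ) - 1) ((α : ℂ) / μ) ((β : ℂ) / μ) _ _ _ _
    (exp_I_mul_conj θ2) (exp_I_mul_conj θ1)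
  push_cast
  rw [← Complex.mul_conj, map_add, map_add, map_one, ← h]
  congr 1
  ext i j
  fin_cases i <;> fin_cases j <;> simp [SKDelta, SKPi] <;> ring

theorem normSq_one_add_exp_add_exp_le (s t : ℝ) :
    Complex.normSq (1 + Complex.exp (Complex.I * s) + Complex.exp (Complex.I * t)) ≤ 9 := by
  have hs : ‖Complex.exp (Complex.I * s)‖ = 1 := by
    rw [mul_comm, Complex.norm_exp_ofReal_mul_I]
  have ht : ‖Complex.exp (Complex.I * t)‖ = 1 := by
    rw [mul_comm, Complex.norm_exp_ofReal_mul_I]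
  have h := norm_add₃_le (a := (1 : ℂ)) (b := Complex.exp (Complex.I * s))
    (c := Complex.exp (Complex.I * t))
  rw [hs, ht, norm_one] at h
  rw [Complex.normSq_eq_norm_sq]
  nlinarith [norm_nonneg (1 + Complex.exp (Complex.I * s) + Complex.exp (Complex.I * t))]

theorem exists_normSq_one_add_exp_add_exp_eq {c : ℝ} (h0 : -1 ≤ c) (h3 : c ≤ 3) :
    ∃ s t : ℝ,
      Complex.normSq (1 + Complex.exp (Complex.I * s) + Complex.exp (Complex.I * t)) = c ^ 2 := by
  refine ⟨Real.arccos ((c - 1) / 2), -Real.arccos ((c - 1) / 2), ?_⟩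
  have hcos : Real.cos (Real.arccos ((c - 1) / 2)) = (c - 1) / 2 :=
    Real.cos_arccos (by linarith) (by linarith)
  generalize Real.arccos ((c - 1) / 2) = t at hcos
  simp only [Complex.normSq_apply, Complex.add_re, Complex.add_im, Complex.one_re,
    Complex.one_im, mul_comm Complex.I, Complex.exp_ofReal_mul_I_re,
    Complex.exp_ofReal_mul_I_im, Real.cos_neg, Real.sin_neg, hcos]
  ring

theorem mem_Icc_union_Icc_iff {m d r x : ℝ} (hd : 0 ≤ d) (hdr : d ≤ r) :
    x ∈ Set.Icc (m - r) (m - d) ∪ Set.Icc (m + d) (m + r) ↔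
      d ^ 2 ≤ (x - m) ^ 2 ∧ (x - m) ^ 2 ≤ r ^ 2 := by
  rw [sq_le_sq, sq_le_sq, abs_of_nonneg hd, abs_of_nonneg (hd.trans hdr)]
  simp only [Set.mem_union, Set.mem_Icc]
  rcases abs_cases (x - m) with ⟨h, h'⟩ | ⟨h, h'⟩ <;> rw [h] <;> constructor
  · rintro (⟨h1, h2⟩ | ⟨h1, h2⟩) <;> constructor <;> linarith
  · rintro ⟨h1, h2⟩
    right; constructor <;> linarith
  · rintro (⟨h1, h2⟩ | ⟨h1, h2⟩) <;> constructor <;> linarith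
  · rintro ⟨h1, h2⟩
    left; constructor <;> linarith

/-- The spectrum of the monomeric Super-Kagome Laplacian, and its flat bands at `3α/μ` and
`2 − α/μ`. -/
theorem super_kagome_monomeric_spectrum
    (μ α β : ℝ) (hμ : 0 < μ) (hα : 0 < α) (hβ : 0 < β) (hab : 2 * α + β = μ) :
    ({lam : ℝ | ∃ θ1 θ2 : ℝ,
        Matrix.det ((lam : ℂ) • (1 : Matrix (Fin 6) (Fin 6) ℂ)
          - SKDelta α α α α α α β β β μ θ1 θ2) = 0}
      = Set.Icc 0 ((1 - α / (2 * μ)) - |3 * α - 2 * β| / (2 * μ))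
        ∪ Set.Icc ((1 - α / (2 * μ)) + |3 * α - 2 * β| / (2 * μ)) (2 - α / μ))
    ∧ (∀ θ1 θ2 : ℝ,
        Matrix.det (((3 * α / μ : ℝ) : ℂ) • (1 : Matrix (Fin 6) (Fin 6) ℂ)
          - SKDelta α α α α α α β β β μ θ1 θ2) = 0
        ∧ Matrix.det (((2 - α / μ : ℝ) : ℂ) • (1 : Matrix (Fin 6) (Fin 6) ℂ)
          - SKDelta α α α α α α β β β μ θ1 θ2) = 0) := by
  obtain ⟨a, ha⟩ : ∃ a, a = α / μ := ⟨_, rfl⟩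
  obtain ⟨b, hb⟩ : ∃ b, b = β / μ := ⟨_, rfl⟩
  have ha0 : 0 < a := ha ▸ div_pos hα hμ
  have hb0 : 0 < b := hb ▸ div_pos hβ hμ
  have hab1 : b = 1 - 2 * a := by
    rw [ha, hb]
    field_simp
    linarith
  have e1 : α / (2 * μ) = a / 2 := by rw [ha]; field_simp
  have e2 : |3 * α - 2 * β| / (2 * μ) = |3 * a - 2 * b| / 2 := by
    have h : 3 * a - 2 * b = (3 * α - 2 * β) / μ := by rw [ha, hb]; ring
    rw [h, abs_div, abs_of_pos hμ]
    field_simp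
  have e3 : 3 * α / μ = 3 * a := by rw [ha]; ring
  simp only [det_smul_one_sub_SKDelta, Complex.ofReal_eq_zero, e1, e2, e3, ← ha, ← hb]
  refine ⟨?_, fun θ1 θ2 => ⟨?_, ?_⟩⟩
  · ext x
    have hd : |3 * a - 2 * b| / 2 ≤ 1 - a / 2 := by
      rcases abs_cases (3 * a - 2 * b) with ⟨h, -⟩ | ⟨h, -⟩ <;> rw [h] <;> linarith
    have hmem := mem_Icc_union_Icc_iff (m := 1 - a / 2) (x := x) (by positivity) hd
    rw [sub_self, show 1 - a / 2 + (1 - a / 2) = 2 - a by ring, div_pow, sq_abs] at hmem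
    rw [hmem, Set.mem_ofPred_eq]
    have hq : (a - (x - 1)) ^ 2 - b ^ 2 - 3 * a * (a - (x - 1)) =
        (x - (1 - a / 2)) ^ 2 - (1 - a / 2) ^ 2 + 3 * a * b := by
      rw [hab1]; ring
    have hab0 : 0 < a * b := mul_pos ha0 hb0
    subst hab1
    constructor
    · rintro ⟨θ1, θ2, h⟩
      rcases mul_eq_zero.mp h with h | h
      · have h' : (x - 3 * a) * (x - (2 - a)) = 0 := by linear_combination h
        rcases mul_eq_zero.mp h' with h' | h'
        · rw [sub_eq_zero.mp h']
          exact ⟨by linear_combination, by linear_combination 6 * hab0⟩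
        · rw [sub_eq_zero.mp h']
          exact ⟨by linear_combination 6 * hab0, by linear_combination⟩
      · rw [hq] at h
        have hN := normSq_one_add_exp_add_exp_le θ2 θ1
        obtain ⟨h1, h2⟩ := abs_le_of_sq_le_sq'
          (a := (x - (1 - a / 2)) ^ 2 - (1 - a / 2) ^ 2 + 3 * a * (1 - 2 * a))
          (b := 3 * (a * (1 - 2 * a)))
          (by
            linear_combination h + mul_le_mul_of_nonneg_left hN (sq_nonneg (a * (1 - 2 * a))))
          (mul_nonneg zero_le_three hab0.le)
        exact ⟨by linear_combination h1, by linear_combination h2⟩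
    · rintro ⟨h1, h2⟩
      obtain ⟨s, t, hst⟩ := exists_normSq_one_add_exp_add_exp_eq
        (c := |(x - (1 - a / 2)) ^ 2 - (1 - a / 2) ^ 2 + 3 * a * (1 - 2 * a)| / (a * (1 - 2 * a)))
        (le_trans (by norm_num) (div_nonneg (abs_nonneg _) hab0.le))
        (by
          rw [div_le_iff₀ hab0, abs_le]
          exact ⟨by linear_combination h1, by linear_combination h2⟩)
      refine ⟨t, s, mul_eq_zero_of_right _ ?_⟩
      rw [hst, hq, div_pow, sq_abs]
      have hne : a * (1 - 2 * a) ≠ 0 := hab0.ne'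
      rw [← mul_pow, mul_div_cancel₀ _ (pow_ne_zero 2 hne), sub_self]
  · rw [hab1]; ring
  · rw [hab1]; ring
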